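/- For every ε > 0 there exists K such that for every integer k ≥ K and every k-uniform cross intersecting matching 𝒜_1, …, 𝒜_t of type (d_1, …, d_t), one has ∑_{i=1}^{t} d_i(d_i − 1) ≤ (1 + ε)·C(2k,k), where C(2k,k) denotes the central binomial coefficient. -/

import Mathlib

/-- A `k`-uniform cross intersecting matching of type `(d 0, …, d (t-1))`:
`t, k ≥ 2`, each `d i ≥ 2`, each family `𝒜 i` consists of `d i` pairwise disjoint
`k`-element sets, and any `X ∈ 𝒜 i`, `Y ∈ 𝒜 j` with `i ≠ j` intersect. -/
def IsCrossIntersectingMatching {α : Type*} [DecidableEq α] (k t : ℕ)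
    (d : Fin t → ℕ) (𝒜 : Fin t → Finset (Finset α)) : Prop :=
  2 ≤ t ∧ 2 ≤ k ∧ (∀ i, 2 ≤ d i) ∧
  (∀ i, (𝒜 i).card = d i) ∧
  (∀ i, ∀ X ∈ 𝒜 i, X.card = k) ∧
  (∀ i, ∀ X ∈ 𝒜 i, ∀ Y ∈ 𝒜 i, X ≠ Y → Disjoint X Y) ∧
  (∀ i j, i ≠ j → ∀ X ∈ 𝒜 i, ∀ Y ∈ 𝒜 j, (X ∩ Y).Nonempty)

/-- The function `f` takes smaller values on `A` than on `B`. -/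
def Precedes {α : Type*} (f : α → ℕ) (A B : Finset α) : Prop :=
  ∀ x ∈ A, ∀ y ∈ B, f x < f y

lemma exists_precedes_sdiff {α : Type*} [DecidableEq α] {f : α → ℕ} {C : Finset α}
    (hf : Set.InjOn f C) {a : ℕ} (ha : a ≤ C.card) :
    ∃ A ∈ C.powersetCard a, Precedes f A (C \ A) := by
  induction a with
  | zero => exact ⟨∅, by simp, by simp [Precedes]⟩
  | succ a ih =>
    obtain ⟨A, hA, h⟩ := ih (by omega)
    rw [Finset.mem_powersetCard] at hA
    have hne : (C \ A).Nonempty := by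
      rw [← Finset.card_pos, Finset.card_sdiff_of_subset hA.1]
      omega
    obtain ⟨m, hm, hmin⟩ := Finset.exists_min_image (C \ A) f hne
    have hm' := Finset.mem_sdiff.1 hm
    refine ⟨insert m A, ?_, ?_⟩
    · rw [Finset.mem_powersetCard, Finset.card_insert_of_notMem hm'.2, hA.2]
      exact ⟨Finset.insert_subset hm'.1 hA.1, rfl⟩
    · intro x hx y hy
      simp only [Finset.mem_sdiff, Finset.mem_insert, not_or] at hx hy
      have hy' : y ∈ C \ A := Finset.mem_sdiff.2 ⟨hy.1, hy.2.2⟩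
      rcases hx with rfl | hx
      · exact lt_of_le_of_ne (hmin y hy') fun e ↦ hy.2.1 (hf hm'.1 hy.1 e).symm
      · exact h x hx y hy'

lemma eq_of_precedes_sdiff {α : Type*} [DecidableEq α] {f : α → ℕ} {A B C : Finset α}
    (hA : A ⊆ C) (hB : B ⊆ C) (hcard : A.card = B.card)
    (h : Precedes f A (C \ A)) (h' : Precedes f B (C \ B)) : A = B := by
  by_contra hne
  obtain ⟨x, hxA, hxB⟩ : ∃ x ∈ A, x ∉ B := by
    by_contra! hs
    exact hne (Finset.eq_of_subset_of_card_le hs hcard.ge)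
  obtain ⟨y, hyB, hyA⟩ : ∃ y ∈ B, y ∉ A := by
    by_contra! hs
    exact hne (Finset.eq_of_subset_of_card_le hs hcard.le).symm
  exact lt_asymm (h x hxA y (Finset.mem_sdiff.2 ⟨hB hyB, hyA⟩))
    (h' y hyB x (Finset.mem_sdiff.2 ⟨hA hxA, hxB⟩))

/-- The position of `x` in the ordering of `V` given by the permutation `σ`
(and `0` outside of `V`). -/
noncomputable def position {α : Type*} [DecidableEq α] (V : Finset α) (σ : Equiv.Perm V) (x : α) :
    ℕ :=
  if h : x ∈ V then V.equivFin (σ ⟨x, h⟩) else 0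

lemma position_coe {α : Type*} [DecidableEq α] {V : Finset α} (σ : Equiv.Perm V) (x : V) :
    position V σ x = V.equivFin (σ x) := by
  simp [position]

lemma injOn_position {α : Type*} [DecidableEq α] (V : Finset α) (σ : Equiv.Perm V) :
    Set.InjOn (position V σ) V := by
  intro x hx y hy h
  rw [position_coe σ ⟨x, hx⟩, position_coe σ ⟨y, hy⟩] at h
  simpa using V.equivFin.injective (Fin.ext h)

lemma exists_perm_map_of_card_eq {α : Type*} [DecidableEq α] {V A B A' B' : Finset α}
    (hA : A ⊆ V) (hB : B ⊆ V) (hAB : Disjoint A B)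
    (hA' : A' ⊆ V) (hB' : B' ⊆ V) (hAB' : Disjoint A' B')
    (ha : A.card = A'.card) (hb : B.card = B'.card) :
    ∃ τ : Equiv.Perm V, (∀ x : V, (x : α) ∈ A → (τ x : α) ∈ A') ∧
      ∀ x : V, (x : α) ∈ B → (τ x : α) ∈ B' := by
  let e := Finset.equivOfCardEq ha
  let e' := Finset.equivOfCardEq hb
  let f : A ⊕ B ↪ V :=
    ⟨Sum.elim (fun x ↦ ⟨x, hA x.2⟩) (fun x ↦ ⟨x, hB x.2⟩), by
      rintro (x | x) (y | y) h
      · exact congrArg _ (Subtype.ext (congrArg (fun v : V ↦ (v : α)) h))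
      · exact absurd (congrArg Subtype.val h) (Finset.disjoint_iff_ne.1 hAB x x.2 y y.2)
      · exact absurd (congrArg Subtype.val h).symm (Finset.disjoint_iff_ne.1 hAB y y.2 x x.2)
      · exact congrArg _ (Subtype.ext (congrArg (fun v : V ↦ (v : α)) h))⟩
  let g : A ⊕ B ↪ V :=
    ⟨Sum.elim (fun x ↦ ⟨e x, hA' (e x).2⟩) (fun x ↦ ⟨e' x, hB' (e' x).2⟩), by
      rintro (x | x) (y | y) h
      · exact congrArg _ (e.injective (Subtype.ext (congrArg (fun v : V ↦ (v : α)) h)))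
      · exact absurd (congrArg Subtype.val h)
          (Finset.disjoint_iff_ne.1 hAB' (e x) (e x).2 (e' y) (e' y).2)
      · exact absurd (congrArg Subtype.val h).symm
          (Finset.disjoint_iff_ne.1 hAB' (e y) (e y).2 (e' x) (e' x).2)
      · exact congrArg _ (e'.injective (Subtype.ext (congrArg (fun v : V ↦ (v : α)) h)))⟩
  obtain ⟨τ, hτ⟩ := Equiv.Perm.exists_extending_pair f g f.injective g.injective
  refine ⟨τ, fun x hx ↦ ?_, fun x hx ↦ ?_⟩
  · have h : τ x = ⟨e ⟨x, hx⟩, _⟩ := hτ (Sum.inl ⟨x, hx⟩)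
    rw [h]
    exact (e ⟨x, hx⟩).2
  · have h : τ x = ⟨e' ⟨x, hx⟩, _⟩ := hτ (Sum.inr ⟨x, hx⟩)
    rw [h]
    exact (e' ⟨x, hx⟩).2

open Classical in
lemma card_precedes_le_of_card_eq {α : Type*} [DecidableEq α] {V A B A' B' : Finset α}
    (hA : A ⊆ V) (hB : B ⊆ V) (hAB : Disjoint A B)
    (hA' : A' ⊆ V) (hB' : B' ⊆ V) (hAB' : Disjoint A' B')
    (ha : A.card = A'.card) (hb : B.card = B'.card) :
    (Finset.univ.filter fun σ : Equiv.Perm V ↦ Precedes (position V σ) A' B').card ≤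
      (Finset.univ.filter fun σ : Equiv.Perm V ↦ Precedes (position V σ) A B).card := by
  obtain ⟨τ, hτA, hτB⟩ := exists_perm_map_of_card_eq hA hB hAB hA' hB' hAB' ha hb
  refine Finset.card_le_card_of_injOn (fun σ ↦ σ * τ) ?_ (mul_left_injective τ).injOn
  intro σ hσ
  simp only [Finset.coe_filter, Finset.mem_univ, true_and, Set.mem_ofPred_eq] at hσ ⊢
  intro x hx y hy
  have h := hσ _ (hτA ⟨x, hA hx⟩ hx) _ (hτB ⟨y, hB hy⟩ hy)
  rw [position_coe, position_coe] at h
  rw [position_coe _ ⟨x, hA hx⟩, position_coe _ ⟨y, hB hy⟩]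
  exact h

open Classical in
/-- A uniformly random ordering puts `A` before `B` with probability `1 / (|A| + |B|).choose |A|`. -/
lemma card_precedes_mul_choose {α : Type*} [DecidableEq α] {V A B : Finset α}
    (hA : A ⊆ V) (hB : B ⊆ V) (hAB : Disjoint A B) :
    (Finset.univ.filter fun σ : Equiv.Perm V ↦ Precedes (position V σ) A B).card *
      (A.card + B.card).choose A.card = Fintype.card (Equiv.Perm V) := by
  have hC : (A ∪ B).card = A.card + B.card := Finset.card_union_of_disjoint hAB
  have hCV : A ∪ B ⊆ V := Finset.union_subset hA hB
  have hconst : ∀ A' ∈ (A ∪ B).powersetCard A.card,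
      (Finset.univ.filter fun σ : Equiv.Perm V ↦
        Precedes (position V σ) A' ((A ∪ B) \ A')).card =
      (Finset.univ.filter fun σ : Equiv.Perm V ↦ Precedes (position V σ) A B).card := by
    intro A' hA'
    rw [Finset.mem_powersetCard] at hA'
    have hB' : ((A ∪ B) \ A').card = B.card := by
      rw [Finset.card_sdiff_of_subset hA'.1]
      omega
    have h1 : A' ⊆ V := hA'.1.trans hCV
    have h2 : (A ∪ B) \ A' ⊆ V := Finset.sdiff_subset.trans hCV
    exact le_antisymm
      (card_precedes_le_of_card_eq hA hB hAB h1 h2 Finset.disjoint_sdiff hA'.2.symm hB'.symm)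
      (card_precedes_le_of_card_eq h1 h2 Finset.disjoint_sdiff hA hB hAB hA'.2 hB')
  have huniq : ∀ σ : Equiv.Perm V, (((A ∪ B).powersetCard A.card).filter fun A' ↦
      Precedes (position V σ) A' ((A ∪ B) \ A')).card = 1 := by
    intro σ
    obtain ⟨A', hA', h⟩ := exists_precedes_sdiff ((injOn_position V σ).mono hCV)
      (show A.card ≤ (A ∪ B).card by omega)
    rw [Finset.card_eq_one]
    refine ⟨A', Finset.eq_singleton_iff_unique_mem.2 ⟨Finset.mem_filter.2 ⟨hA', h⟩, ?_⟩⟩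
    intro A'' hA''
    rw [Finset.mem_filter, Finset.mem_powersetCard] at hA''
    rw [Finset.mem_powersetCard] at hA'
    exact eq_of_precedes_sdiff hA''.1.1 hA'.1 (hA''.1.2.trans hA'.2.symm) hA''.2 h
  have hsum := Finset.sum_card_bipartiteAbove_eq_sum_card_bipartiteBelow
    (s := (A ∪ B).powersetCard A.card) (t := (Finset.univ : Finset (Equiv.Perm V)))
    (fun A' σ ↦ Precedes (position V σ) A' ((A ∪ B) \ A'))
  simp only [Finset.bipartiteAbove, Finset.bipartiteBelow] at hsum
  rw [Finset.sum_congr rfl hconst, Finset.sum_congr rfl fun σ _ ↦ huniq σ] at hsum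
  simpa [Finset.card_powersetCard, hC, mul_comm, Fintype.card_perm] using hsum

/-- The pairs of distinct members of a family whose first member precedes the second. -/
noncomputable def precedingPairs {α : Type*} [DecidableEq α] (f : α → ℕ)
    (𝒜 : Finset (Finset α)) : Finset (Finset α × Finset α) :=
  open Classical in 𝒜.offDiag.filter fun p ↦ Precedes f p.1 p.2

/-- The triples of distinct members of a family. -/
def distinctTriples {α : Type*} [DecidableEq α] (𝒜 : Finset (Finset α)) :
    Finset ((Finset α × Finset α) × Finset α) :=
  (𝒜.offDiag ×ˢ 𝒜).filter fun q ↦ q.2 ≠ q.1.1 ∧ q.2 ≠ q.1.2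

/-- The triples of distinct members of a family whose last member precedes the first two. -/
noncomputable def forkTriples {α : Type*} [DecidableEq α] (f : α → ℕ)
    (𝒜 : Finset (Finset α)) : Finset ((Finset α × Finset α) × Finset α) :=
  open Classical in (distinctTriples 𝒜).filter fun q ↦ Precedes f q.2 (q.1.1 ∪ q.1.2)

/-- The triples of distinct members of a family whose first two members precede the last. -/
noncomputable def joinTriples {α : Type*} [DecidableEq α] (f : α → ℕ)
    (𝒜 : Finset (Finset α)) : Finset ((Finset α × Finset α) × Finset α) :=
  open Classical in (distinctTriples 𝒜).filter fun q ↦ Precedes f (q.1.1 ∪ q.1.2) q.2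

lemma mem_distinctTriples {α : Type*} [DecidableEq α] {𝒜 : Finset (Finset α)} {X Y Z : Finset α} :
    ((X, Y), Z) ∈ distinctTriples 𝒜 ↔
      X ∈ 𝒜 ∧ Y ∈ 𝒜 ∧ Z ∈ 𝒜 ∧ X ≠ Y ∧ Z ≠ X ∧ Z ≠ Y := by
  simp only [distinctTriples, Finset.mem_filter, Finset.mem_product, Finset.mem_offDiag]
  tauto

lemma precedes_union_left {α : Type*} [DecidableEq α] {f : α → ℕ} {A B C : Finset α} :
    Precedes f (A ∪ B) C ↔ Precedes f A C ∧ Precedes f B C := by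
  simp only [Precedes, Finset.mem_union, or_imp, forall_and]

lemma precedes_union_right {α : Type*} [DecidableEq α] {f : α → ℕ} {A B C : Finset α} :
    Precedes f A (B ∪ C) ↔ Precedes f A B ∧ Precedes f A C := by
  simp only [Precedes, Finset.mem_union, or_imp, forall_and]

/-- Of two preceding pairs, the first member of one precedes the second members of both. -/
lemma Precedes.cross {α : Type*} {f : α → ℕ} {A B A' B' : Finset α}
    (h : Precedes f A A') (h' : Precedes f B B') : Precedes f A B' ∨ Precedes f B A' := by
  by_contra! hn
  simp only [Precedes, not_forall, not_lt] at hn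
  obtain ⟨⟨x, hx, y, hy, hxy⟩, z, hz, w, hw, hzw⟩ := hn
  have h1 := h x hx w hw
  have h2 := h' z hz y hy
  omega

lemma not_precedes_self {α : Type*} {f : α → ℕ} {A : Finset α} (hA : A.Nonempty) :
    ¬ Precedes f A A := by
  obtain ⟨x, hx⟩ := hA
  exact fun h ↦ lt_irrefl _ (h x hx x hx)

lemma triples_pos_of_ne {α : Type*} [DecidableEq α] {f : α → ℕ} {𝒜 : Finset (Finset α)}
    (hne : ∀ X ∈ 𝒜, X.Nonempty) {p q : Finset α × Finset α}
    (hp : p ∈ precedingPairs f 𝒜) (hq : q ∈ precedingPairs f 𝒜) (hpq : p ≠ q) :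
    0 < (forkTriples f 𝒜).card + (joinTriples f 𝒜).card := by
  classical
  obtain ⟨X, X'⟩ := p
  obtain ⟨Y, Y'⟩ := q
  simp only [precedingPairs, Finset.mem_filter, Finset.mem_offDiag] at hp hq
  obtain ⟨⟨hX, hX', hXX'⟩, h⟩ := hp
  obtain ⟨⟨hY, hY', hYY'⟩, h'⟩ := hq
  have hfork : ∀ Z ∈ 𝒜, X' ≠ Y' → Precedes f Z X' → Precedes f Z Y' →
      0 < (forkTriples f 𝒜).card := by
    intro Z hZ hne' h1 h2
    refine Finset.card_pos.2 ⟨((X', Y'), Z), Finset.mem_filter.2 ⟨mem_distinctTriples.2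
      ⟨hX', hY', hZ, hne', ?_, ?_⟩, precedes_union_right.2 ⟨h1, h2⟩⟩⟩
    · rintro rfl
      exact not_precedes_self (hne _ hZ) h1
    · rintro rfl
      exact not_precedes_self (hne _ hZ) h2
  by_cases he : X' = Y'
  · subst he
    have hXY : X ≠ Y := fun e ↦ hpq (by rw [e])
    exact Nat.add_pos_right _ (Finset.card_pos.2 ⟨((X, Y), X'), Finset.mem_filter.2
      ⟨mem_distinctTriples.2 ⟨hX, hY, hX', hXY, hXX'.symm, hYY'.symm⟩,
        precedes_union_left.2 ⟨h, h'⟩⟩⟩)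
  · rcases h.cross h' with hc | hc
    · exact Nat.add_pos_left (hfork X hX he h hc) _
    · exact Nat.add_pos_left (hfork Y hY he hc h') _

lemma card_precedingPairs_le {α : Type*} [DecidableEq α] {f : α → ℕ} {𝒜 : Finset (Finset α)}
    (hne : ∀ X ∈ 𝒜, X.Nonempty) :
    (precedingPairs f 𝒜).card ≤ (if (precedingPairs f 𝒜).Nonempty then 1 else 0) +
      𝒜.card ^ 2 * ((forkTriples f 𝒜).card + (joinTriples f 𝒜).card) := by
  classical
  by_cases h1 : (precedingPairs f 𝒜).card ≤ 1
  · split_ifs with h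
    · omega
    · simp [Finset.not_nonempty_iff_eq_empty.1 h]
  · obtain ⟨p, hp, q, hq, hpq⟩ := Finset.one_lt_card.1 (not_le.1 h1)
    have h0 := triples_pos_of_ne hne hp hq hpq
    have h2 : (precedingPairs f 𝒜).card ≤ 𝒜.card ^ 2 := by
      refine (Finset.card_filter_le _ _).trans ?_
      rw [Finset.offDiag_card, sq]
      exact Nat.sub_le _ _
    calc _ ≤ 𝒜.card ^ 2 * 1 := by omega
      _ ≤ 𝒜.card ^ 2 * ((forkTriples f 𝒜).card + (joinTriples f 𝒜).card) :=
        Nat.mul_le_mul_left _ h0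
      _ ≤ _ := Nat.le_add_left _ _

lemma card_distinctTriples_le {α : Type*} [DecidableEq α] (𝒜 : Finset (Finset α)) :
    (distinctTriples 𝒜).card ≤ 𝒜.card * (𝒜.card - 1) * 𝒜.card := by
  refine (Finset.card_filter_le _ _).trans ?_
  rw [Finset.card_product, Finset.offDiag_card, Nat.mul_sub_one]

lemma sum_card_filter_precedes_mul {α ι : Type*} [DecidableEq α] {V : Finset α} (s : Finset ι)
    {A B : ι → Finset α} {a b : ℕ} (hA : ∀ i ∈ s, A i ⊆ V) (hB : ∀ i ∈ s, B i ⊆ V)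
    (hAB : ∀ i ∈ s, Disjoint (A i) (B i)) (ha : ∀ i ∈ s, (A i).card = a)
    (hb : ∀ i ∈ s, (B i).card = b) :
    (∑ σ : Equiv.Perm V, (open Classical in
      (s.filter fun i ↦ Precedes (position V σ) (A i) (B i)).card)) * (a + b).choose a =
      s.card * Fintype.card (Equiv.Perm V) := by
  classical
  have hsum := Finset.sum_card_bipartiteAbove_eq_sum_card_bipartiteBelow
    (s := s) (t := (Finset.univ : Finset (Equiv.Perm V)))
    (fun i σ ↦ Precedes (position V σ) (A i) (B i))
  simp only [Finset.bipartiteAbove, Finset.bipartiteBelow] at hsum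
  rw [← hsum, Finset.sum_mul, ← smul_eq_mul, ← Finset.sum_const]
  refine Finset.sum_congr rfl fun i hi ↦ ?_
  rw [← card_precedes_mul_choose (hA i hi) (hB i hi) (hAB i hi), ha i hi, hb i hi]

lemma sum_card_precedingPairs_mul {α : Type*} [DecidableEq α] {V : Finset α}
    {𝒜 : Finset (Finset α)} {k : ℕ} (hV : ∀ X ∈ 𝒜, X ⊆ V) (hk : ∀ X ∈ 𝒜, X.card = k)
    (hd : ∀ X ∈ 𝒜, ∀ Y ∈ 𝒜, X ≠ Y → Disjoint X Y) :
    (∑ σ : Equiv.Perm V, (precedingPairs (position V σ) 𝒜).card) * (2 * k).choose k =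
      𝒜.card * (𝒜.card - 1) * Fintype.card (Equiv.Perm V) := by
  rw [two_mul, Nat.mul_sub_one, ← Finset.offDiag_card]
  simp only [precedingPairs]
  apply sum_card_filter_precedes_mul
  all_goals
    intro p hp
    rw [Finset.mem_offDiag] at hp
  · exact hV _ hp.1
  · exact hV _ hp.2.1
  · exact hd _ hp.1 _ hp.2.1 hp.2.2
  · exact hk _ hp.1
  · exact hk _ hp.2.1

lemma sum_card_forkTriples_mul {α : Type*} [DecidableEq α] {V : Finset α}
    {𝒜 : Finset (Finset α)} {k : ℕ} (hV : ∀ X ∈ 𝒜, X ⊆ V) (hk : ∀ X ∈ 𝒜, X.card = k)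
    (hd : ∀ X ∈ 𝒜, ∀ Y ∈ 𝒜, X ≠ Y → Disjoint X Y) :
    (∑ σ : Equiv.Perm V, (forkTriples (position V σ) 𝒜).card) * (3 * k).choose k =
      (distinctTriples 𝒜).card * Fintype.card (Equiv.Perm V) := by
  rw [show 3 * k = k + 2 * k by ring]
  simp only [forkTriples]
  apply sum_card_filter_precedes_mul
  all_goals
    rintro ⟨⟨X, Y⟩, Z⟩ hp
    obtain ⟨hX, hY, hZ, hXY, hZX, hZY⟩ := mem_distinctTriples.1 hp
  · exact hV _ hZ
  · exact Finset.union_subset (hV _ hX) (hV _ hY)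
  · exact Finset.disjoint_union_right.2 ⟨hd _ hZ _ hX hZX, hd _ hZ _ hY hZY⟩
  · exact hk _ hZ
  · rw [Finset.card_union_of_disjoint (hd _ hX _ hY hXY), hk _ hX, hk _ hY, two_mul]

lemma sum_card_joinTriples_mul {α : Type*} [DecidableEq α] {V : Finset α}
    {𝒜 : Finset (Finset α)} {k : ℕ} (hV : ∀ X ∈ 𝒜, X ⊆ V) (hk : ∀ X ∈ 𝒜, X.card = k)
    (hd : ∀ X ∈ 𝒜, ∀ Y ∈ 𝒜, X ≠ Y → Disjoint X Y) :
    (∑ σ : Equiv.Perm V, (joinTriples (position V σ) 𝒜).card) * (3 * k).choose k =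
      (distinctTriples 𝒜).card * Fintype.card (Equiv.Perm V) := by
  rw [show 3 * k = 2 * k + k by ring, ← Nat.choose_symm_add]
  simp only [joinTriples]
  apply sum_card_filter_precedes_mul
  all_goals
    rintro ⟨⟨X, Y⟩, Z⟩ hp
    obtain ⟨hX, hY, hZ, hXY, hZX, hZY⟩ := mem_distinctTriples.1 hp
  · exact Finset.union_subset (hV _ hX) (hV _ hY)
  · exact hV _ hZ
  · exact Finset.disjoint_union_left.2 ⟨hd _ hX _ hZ hZX.symm, hd _ hY _ hZ hZY.symm⟩
  · rw [Finset.card_union_of_disjoint (hd _ hX _ hY hXY), hk _ hX, hk _ hY, two_mul]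
  · exact hk _ hZ

lemma card_le_of_disjoint_of_inter_nonempty {α : Type*} [DecidableEq α] {𝒜 : Finset (Finset α)}
    {Y : Finset α} (hd : ∀ X ∈ 𝒜, ∀ X' ∈ 𝒜, X ≠ X' → Disjoint X X')
    (hY : ∀ X ∈ 𝒜, (X ∩ Y).Nonempty) : 𝒜.card ≤ Y.card := by
  rcases 𝒜.eq_empty_or_nonempty with rfl | ⟨X₀, hX₀⟩
  · simp
  have : Nonempty α := ⟨(hY X₀ hX₀).choose⟩
  choose! g hg using hY
  refine Finset.card_le_card_of_injOn g (fun X hX ↦ (Finset.mem_inter.1 (hg X hX)).2) ?_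
  intro X hX X' hX' h
  by_contra hne
  refine Finset.disjoint_left.1 (hd X hX X' hX' hne) (Finset.mem_inter.1 (hg X hX)).1 ?_
  rw [h]
  exact (Finset.mem_inter.1 (hg X' hX')).1

lemma sum_ite_precedingPairs_nonempty_le_one {α ι : Type*} [DecidableEq α] [Fintype ι]
    {𝒜 : ι → Finset (Finset α)}
    (hcross : ∀ i j, i ≠ j → ∀ X ∈ 𝒜 i, ∀ Y ∈ 𝒜 j, (X ∩ Y).Nonempty) (f : α → ℕ) :
    ∑ i, (if (precedingPairs f (𝒜 i)).Nonempty then 1 else 0) ≤ 1 := by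
  rw [← Finset.card_filter, Finset.card_le_one]
  intro i hi j hj
  by_contra hij
  obtain ⟨p, hp⟩ := (Finset.mem_filter.1 hi).2
  obtain ⟨q, hq⟩ := (Finset.mem_filter.1 hj).2
  simp only [precedingPairs, Finset.mem_filter, Finset.mem_offDiag] at hp hq
  have key : ∀ {A B : Finset α}, (A ∩ B).Nonempty → ¬ Precedes f A B := by
    rintro A B ⟨x, hx⟩ h
    rw [Finset.mem_inter] at hx
    exact lt_irrefl _ (h x hx.1 x hx.2)
  rcases hp.2.cross hq.2 with h | h
  · exact key (hcross i j hij _ hp.1.1 _ hq.1.2.1) h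
  · exact key (hcross j i (Ne.symm hij) _ hq.1.1 _ hp.1.2.1) h

lemma IsCrossIntersectingMatching.le_uniformity {α : Type*} [DecidableEq α] {k t : ℕ}
    {d : Fin t → ℕ} {𝒜 : Fin t → Finset (Finset α)} (h : IsCrossIntersectingMatching k t d 𝒜)
    (i : Fin t) : d i ≤ k := by
  obtain ⟨ht, -, hd2, hcard, hk, hdis, hcross⟩ := h
  have : Nontrivial (Fin t) := Fin.nontrivial_iff_two_le.2 ht
  obtain ⟨j, hj⟩ := exists_ne i
  obtain ⟨Y, hY⟩ : (𝒜 j).Nonempty := by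
    rw [← Finset.card_pos, hcard]
    exact two_pos.trans_le (hd2 j)
  rw [← hcard i, ← hk j Y hY]
  exact card_le_of_disjoint_of_inter_nonempty (hdis i) fun X hX ↦ hcross i j hj.symm X hX Y hY

/-- Bonferroni-type bound on the type of a cross intersecting matching. -/
lemma IsCrossIntersectingMatching.sum_div_le {α : Type*} [DecidableEq α] {k t : ℕ}
    {d : Fin t → ℕ} {𝒜 : Fin t → Finset (Finset α)} (h : IsCrossIntersectingMatching k t d 𝒜) :
    ((∑ i, d i * (d i - 1) : ℕ) : ℝ) / (2 * k).choose k ≤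
      1 + 2 * k ^ 3 * ((∑ i, d i * (d i - 1) : ℕ) : ℝ) / (3 * k).choose k := by
  have hdk := h.le_uniformity
  obtain ⟨-, hk2, hd2, hcard, hk, hdis, hcross⟩ := h
  let V : Finset α := Finset.univ.biUnion fun i ↦ (𝒜 i).biUnion id
  have hV : ∀ i, ∀ X ∈ 𝒜 i, X ⊆ V := fun i X hX x hx ↦
    Finset.mem_biUnion.2 ⟨i, Finset.mem_univ i, Finset.mem_biUnion.2 ⟨X, hX, hx⟩⟩
  have hne : ∀ i, ∀ X ∈ 𝒜 i, X.Nonempty := by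
    intro i X hX
    rw [← Finset.card_pos, hk i X hX]
    omega
  set M : ℝ := ((Fintype.card (Equiv.Perm V) : ℕ) : ℝ) with hM
  have hMpos : 0 < M := by
    rw [hM]
    exact_mod_cast Fintype.card_pos
  have hC2 : (0 : ℝ) < (2 * k).choose k := by exact_mod_cast Nat.choose_pos (by omega)
  have hC3 : (0 : ℝ) < (3 * k).choose k := by exact_mod_cast Nat.choose_pos (by omega)
  have hpairs : ∀ i, ((∑ σ : Equiv.Perm V, (precedingPairs (position V σ) (𝒜 i)).card : ℕ) : ℝ) =
      (d i * (d i - 1) : ℕ) * M / (2 * k).choose k := by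
    intro i
    rw [eq_div_iff hC2.ne', hM, ← hcard i]
    exact_mod_cast sum_card_precedingPairs_mul (hV i) (hk i) (hdis i)
  have htriples : ∀ i, ((distinctTriples (𝒜 i)).card : ℝ) ≤ (d i * (d i - 1) : ℕ) * k := by
    intro i
    have h1 := card_distinctTriples_le (𝒜 i)
    rw [hcard i] at h1
    exact_mod_cast h1.trans (Nat.mul_le_mul_left _ (hdk i))
  have hfork : ∀ i, ((∑ σ : Equiv.Perm V, (forkTriples (position V σ) (𝒜 i)).card : ℕ) : ℝ) ≤
      (d i * (d i - 1) : ℕ) * k * M / (3 * k).choose k := by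
    intro i
    rw [le_div_iff₀ hC3]
    calc _ = ((distinctTriples (𝒜 i)).card : ℝ) * M := by
          rw [hM]
          exact_mod_cast sum_card_forkTriples_mul (hV i) (hk i) (hdis i)
      _ ≤ _ := mul_le_mul_of_nonneg_right (htriples i) hMpos.le
  have hjoin : ∀ i, ((∑ σ : Equiv.Perm V, (joinTriples (position V σ) (𝒜 i)).card : ℕ) : ℝ) ≤
      (d i * (d i - 1) : ℕ) * k * M / (3 * k).choose k := by
    intro i
    rw [le_div_iff₀ hC3]
    calc _ = ((distinctTriples (𝒜 i)).card : ℝ) * M := by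
          rw [hM]
          exact_mod_cast sum_card_joinTriples_mul (hV i) (hk i) (hdis i)
      _ ≤ _ := mul_le_mul_of_nonneg_right (htriples i) hMpos.le
  have hcount : ∑ i, ∑ σ : Equiv.Perm V, (precedingPairs (position V σ) (𝒜 i)).card ≤
      Fintype.card (Equiv.Perm V) + ∑ i, k ^ 2 *
        (∑ σ : Equiv.Perm V, (forkTriples (position V σ) (𝒜 i)).card +
          ∑ σ : Equiv.Perm V, (joinTriples (position V σ) (𝒜 i)).card) := by
    calc _ ≤ ∑ i, ∑ σ : Equiv.Perm V,
          ((if (precedingPairs (position V σ) (𝒜 i)).Nonempty then 1 else 0) +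
            k ^ 2 * ((forkTriples (position V σ) (𝒜 i)).card +
              (joinTriples (position V σ) (𝒜 i)).card)) := by
          refine Finset.sum_le_sum fun i _ ↦ Finset.sum_le_sum fun σ _ ↦
            (card_precedingPairs_le (hne i)).trans ?_
          have := hdk i
          rw [hcard i]
          gcongr
      _ = ∑ σ : Equiv.Perm V, ∑ i,
            (if (precedingPairs (position V σ) (𝒜 i)).Nonempty then 1 else 0) +
          ∑ i, k ^ 2 * (∑ σ : Equiv.Perm V, (forkTriples (position V σ) (𝒜 i)).card +
            ∑ σ : Equiv.Perm V, (joinTriples (position V σ) (𝒜 i)).card) := by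
          rw [Finset.sum_comm (s := (Finset.univ : Finset (Equiv.Perm V))),
            ← Finset.sum_add_distrib]
          refine Finset.sum_congr rfl fun i _ ↦ ?_
          simp only [Finset.sum_add_distrib, Finset.mul_sum, mul_add]
      _ ≤ _ := by
          gcongr
          refine (Finset.sum_le_sum fun σ _ ↦
            sum_ite_precedingPairs_nonempty_le_one hcross (position V σ)).trans ?_
          simp
  have hreal : ∑ i, (((d i * (d i - 1) : ℕ) : ℝ) * M / (2 * k).choose k) ≤
      M + ∑ i, (k : ℝ) ^ 2 * (((d i * (d i - 1) : ℕ) : ℝ) * k * M / (3 * k).choose k +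
        ((d i * (d i - 1) : ℕ) : ℝ) * k * M / (3 * k).choose k) := by
    rw [← Finset.sum_congr rfl fun i _ ↦ hpairs i]
    refine le_trans (Nat.cast_le (α := ℝ).2 hcount |>.trans_eq' (by push_cast; rfl)) ?_
    rw [Nat.cast_add, Nat.cast_sum]
    refine add_le_add le_rfl (Finset.sum_le_sum fun i _ ↦ ?_)
    rw [Nat.cast_mul, Nat.cast_pow, Nat.cast_add]
    exact mul_le_mul_of_nonneg_left (add_le_add (hfork i) (hjoin i)) (by positivity)
  rw [← Finset.sum_div, ← Finset.sum_mul, ← Finset.mul_sum, Finset.sum_add_distrib,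
    ← Finset.sum_div, ← Finset.sum_mul, ← Finset.sum_mul, ← Nat.cast_sum] at hreal
  refine le_of_mul_le_mul_right ?_ hMpos
  calc _ = _ := by ring
    _ ≤ _ := hreal
    _ = _ := by ring

lemma three_pow_mul_ascFactorial_le (k j : ℕ) (hj : j ≤ k) :
    3 ^ j * (k + 1).ascFactorial j ≤ 2 ^ j * (2 * k + 1).ascFactorial j := by
  induction j with
  | zero => simp
  | succ j ih =>
    rw [Nat.ascFactorial_succ, Nat.ascFactorial_succ]
    calc 3 ^ (j + 1) * ((k + 1 + j) * (k + 1).ascFactorial j)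
        = 3 * (k + 1 + j) * (3 ^ j * (k + 1).ascFactorial j) := by ring
      _ ≤ 2 * (2 * k + 1 + j) * (2 ^ j * (2 * k + 1).ascFactorial j) :=
          Nat.mul_le_mul (by omega) (ih (by omega))
      _ = _ := by ring

lemma three_pow_mul_choose_le (k : ℕ) :
    3 ^ k * (2 * k).choose k ≤ 2 ^ k * (3 * k).choose k := by
  have h := three_pow_mul_ascFactorial_le k k le_rfl
  rw [Nat.ascFactorial_eq_factorial_mul_choose, Nat.ascFactorial_eq_factorial_mul_choose,
    ← two_mul, show 2 * k + k = 3 * k by ring] at h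
  refine Nat.le_of_mul_le_mul_left ?_ k.factorial_pos
  linarith


/-- For every `ε > 0` there is `K` such that for all `k ≥ K`, every `k`-uniform cross
intersecting matching of type `(d_1, …, d_t)` satisfies
`∑ i, d i (d i − 1) ≤ (1 + ε)·C(2k,k)`. -/
theorem stmt_2 :
    ∀ ε : ℝ, 0 < ε → ∃ K : ℕ, ∀ k : ℕ, K ≤ k →
      ∀ (α : Type) [DecidableEq α], ∀ (t : ℕ) (d : Fin t → ℕ)
        (𝒜 : Fin t → Finset (Finset α)),
        IsCrossIntersectingMatching k t d 𝒜 →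
        ((∑ i, d i * (d i - 1) : ℕ) : ℝ) ≤ (1 + ε) * Nat.choose (2 * k) k := by
  intro ε hε
  have hlim := (tendsto_pow_const_mul_const_pow_of_abs_lt_one 3
    (show |(2 / 3 : ℝ)| < 1 by norm_num [abs_of_pos])).const_mul 2
  rw [mul_zero] at hlim
  have hpos : 0 < ε / (1 + ε) := by positivity
  obtain ⟨K, hK⟩ := Filter.eventually_atTop.1 (hlim.eventually (gt_mem_nhds hpos))
  refine ⟨K, fun k hk α _ t d 𝒜 h ↦ ?_⟩
  have hη := hK k hk
  have hS := h.sum_div_le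
  set S : ℝ := ((∑ i, d i * (d i - 1) : ℕ) : ℝ)
  have hS0 : 0 ≤ S := Nat.cast_nonneg _
  have hC2 : (0 : ℝ) < (2 * k).choose k := by exact_mod_cast Nat.choose_pos (by omega)
  have hC3 : (0 : ℝ) < (3 * k).choose k := by exact_mod_cast Nat.choose_pos (by omega)
  have hchoose : (1 : ℝ) / (3 * k).choose k ≤ (2 / 3) ^ k / (2 * k).choose k := by
    rw [div_le_div_iff₀ hC3 hC2, div_pow, one_mul, div_mul_eq_mul_div, le_div_iff₀ (by positivity),
      mul_comm]
    exact_mod_cast three_pow_mul_choose_le k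
  have hbound : S / (2 * k).choose k ≤ 1 + ε / (1 + ε) * (S / (2 * k).choose k) := by
    refine hS.trans (add_le_add le_rfl ?_)
    calc 2 * (k : ℝ) ^ 3 * S / (3 * k).choose k
        = 2 * (k : ℝ) ^ 3 * S * (1 / (3 * k).choose k) := by ring
      _ ≤ 2 * (k : ℝ) ^ 3 * S * ((2 / 3) ^ k / (2 * k).choose k) := by gcongr
      _ = 2 * ((k : ℝ) ^ 3 * (2 / 3) ^ k) * (S / (2 * k).choose k) := by ring
      _ ≤ _ := by gcongr
  rw [← div_le_iff₀ hC2]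
  set s := S / (2 * k).choose k
  have he : (1 + ε) * (ε / (1 + ε)) = ε := by field_simp
  have := mul_le_mul_of_nonneg_left hbound (show 0 ≤ 1 + ε by linarith)
  rw [mul_add, ← mul_assoc, he] at this
  linarith
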